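/- arXiv:1807.06841 — 7 statements merged into one kernel-verified Lean document; each statement's English description precedes it below -/
import Mathlib

section
/- Let n ≥ 1, let G be a connected simple graph on the vertex set Fin n, let b : Fin n → Fin n → ℝ be a symmetric weight function with b i j > 0 for every pair of adjacent vertices i, j, and let a : Fin n → ℝ satisfy a i ≥ 0 for all i and a i₀ > 0 for at least one index i₀ (i.e. the diagonal matrix A = diag(a) is positive semidefinite and nonzero). Then the matrix A + L(G,b) is invertible. -/
open Classical Matrix

/-- The weighted Laplacian of a simple graph `G` on `Fin n` with weight function `b`. -/
noncomputable def weightedLaplacian {n : ℕ} (G : SimpleGraph (Fin n))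
    (b : Fin n → Fin n → ℝ) : Matrix (Fin n) (Fin n) ℝ :=
  Matrix.of fun i j =>
    if i = j then ∑ k, (if G.Adj i k then b i k else 0)
    else if G.Adj i j then -b i j else 0

theorem weightedLaplacian_mulVec_apply {n : ℕ} (G : SimpleGraph (Fin n))
    (b : Fin n → Fin n → ℝ) (x : Fin n → ℝ) (i : Fin n) :
    (weightedLaplacian G b *ᵥ x) i = ∑ k, (if G.Adj i k then b i k * (x i - x k) else 0) := by
  have h : ∀ k, weightedLaplacian G b i k * x k =
      (if i = k then (∑ l, if G.Adj i l then b i l else 0) * x i else 0) -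
        (if G.Adj i k then b i k * x k else 0) := by
    intro k
    by_cases hik : i = k
    · subst hik
      simp [weightedLaplacian]
    · by_cases hadj : G.Adj i k <;> simp [weightedLaplacian, hik, hadj]
  simp only [mulVec, dotProduct, h, Finset.sum_sub_distrib, Finset.sum_ite_eq, Finset.mem_univ,
    if_true, Finset.sum_mul]
  rw [← Finset.sum_sub_distrib]
  refine Finset.sum_congr rfl fun k _ => ?_
  split_ifs <;> ring

/-- The quadratic form of the weighted Laplacian is the weighted Dirichlet energy. -/
theorem two_mul_dotProduct_weightedLaplacian_mulVec {n : ℕ} (G : SimpleGraph (Fin n))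
    (b : Fin n → Fin n → ℝ) (hsymm : ∀ i j, b i j = b j i) (x : Fin n → ℝ) :
    2 * (x ⬝ᵥ weightedLaplacian G b *ᵥ x) =
      ∑ i, ∑ k, (if G.Adj i k then b i k * (x i - x k) ^ 2 else 0) := by
  have h : x ⬝ᵥ weightedLaplacian G b *ᵥ x =
      ∑ i, ∑ k, (if G.Adj i k then b i k * (x i * (x i - x k)) else 0) := by
    simp only [dotProduct, weightedLaplacian_mulVec_apply, Finset.mul_sum]
    refine Finset.sum_congr rfl fun i _ => Finset.sum_congr rfl fun k _ => ?_
    split_ifs <;> ring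
  have h' := h
  rw [Finset.sum_comm] at h'
  rw [two_mul]
  nth_rewrite 1 [h]
  rw [h', ← Finset.sum_add_distrib]
  refine Finset.sum_congr rfl fun i _ => ?_
  rw [← Finset.sum_add_distrib]
  refine Finset.sum_congr rfl fun k _ => ?_
  rw [G.adj_comm k i, hsymm k i]
  split_ifs <;> ring

theorem diag_add_weighted_laplacian_invertible
    (n : ℕ) (hn : 1 ≤ n) (G : SimpleGraph (Fin n)) (hG : G.Connected)
    (b : Fin n → Fin n → ℝ) (hsymm : ∀ i j, b i j = b j i)
    (hpos : ∀ i j, G.Adj i j → 0 < b i j)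
    (a : Fin n → ℝ) (ha : ∀ i, 0 ≤ a i) (ha' : ∃ i₀, 0 < a i₀) :
    IsUnit (Matrix.diagonal a + weightedLaplacian G b) := by
  rw [Matrix.isUnit_iff_isUnit_det, isUnit_iff_ne_zero]
  intro hdet
  obtain ⟨x, hx0, hx⟩ := Matrix.exists_mulVec_eq_zero_iff.mpr hdet
  have hterm : ∀ i k, 0 ≤ if G.Adj i k then b i k * (x i - x k) ^ 2 else 0 := by
    intro i k
    split_ifs with hadj
    · exact mul_nonneg (hpos i k hadj).le (sq_nonneg _)
    · exact le_rfl
  have hdiag : x ⬝ᵥ Matrix.diagonal a *ᵥ x = ∑ i, a i * x i ^ 2 := by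
    simp only [dotProduct, mulVec_diagonal]
    exact Finset.sum_congr rfl fun i _ => by ring
  have hdiag_term : ∀ i, 0 ≤ a i * x i ^ 2 := fun i => mul_nonneg (ha i) (sq_nonneg _)
  have hdiag_nonneg := Finset.sum_nonneg fun i (_ : i ∈ Finset.univ) => hdiag_term i
  have henergy_nonneg := Finset.sum_nonneg fun i (_ : i ∈ Finset.univ) =>
    Finset.sum_nonneg fun k (_ : k ∈ Finset.univ) => hterm i k
  have htotal : x ⬝ᵥ Matrix.diagonal a *ᵥ x + x ⬝ᵥ weightedLaplacian G b *ᵥ x = 0 := by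
    rw [← dotProduct_add, ← add_mulVec, hx, dotProduct_zero]
  have henergy := two_mul_dotProduct_weightedLaplacian_mulVec G b hsymm x
  rw [hdiag] at htotal
  have hdiag_zero : ∑ i, a i * x i ^ 2 = 0 := by linarith
  have henergy_zero :
      ∑ i, ∑ k, (if G.Adj i k then b i k * (x i - x k) ^ 2 else 0) = 0 := by linarith
  have hadj_eq : ∀ i k, G.Adj i k → x i = x k := by
    intro i k hadj
    have h₁ := (Finset.sum_eq_zero_iff_of_nonneg fun i _ =>
      Finset.sum_nonneg fun k _ => hterm i k).mp henergy_zero i (Finset.mem_univ i)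
    have h₂ := (Finset.sum_eq_zero_iff_of_nonneg fun k _ => hterm i k).mp h₁ k (Finset.mem_univ k)
    rw [if_pos hadj] at h₂
    have h₃ := (mul_eq_zero.mp h₂).resolve_left (hpos i k hadj).ne'
    exact sub_eq_zero.mp (pow_eq_zero_iff two_ne_zero |>.mp h₃)
  have hwalk : ∀ {i k : Fin n}, G.Walk i k → x i = x k := by
    intro i k p
    induction p with
    | nil => rfl
    | cons hadj _ ih => exact (hadj_eq _ _ hadj).trans ih
  obtain ⟨i₀, hi₀⟩ := ha'
  have hxi₀ : x i₀ = 0 := by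
    have h := (Finset.sum_eq_zero_iff_of_nonneg fun i _ => hdiag_term i).mp hdiag_zero i₀
      (Finset.mem_univ i₀)
    exact pow_eq_zero_iff two_ne_zero |>.mp ((mul_eq_zero.mp h).resolve_left hi₀.ne')
  refine hx0 (funext fun i => ?_)
  obtain ⟨p⟩ := hG.preconnected i i₀
  exact (hwalk p).trans hxi₀
end

section
/- Let n ≥ 1, let b : Fin n → Fin n → ℝ be a symmetric function with b i j > 0 for all i ≠ j, and let G and H be connected simple graphs on Fin n with G ≠ H. Then the restrictions of the weighted Laplacians L(G,b) and L(H,b) to the hyperplane orthogonal to the all-ones vector are distinct: there exists a vector x ∈ ℝ^n with Σ_i x i = 0 such that L(G,b) · x ≠ L(H,b) · x. -/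
open Classical Matrix

theorem weightedLaplacian_mulVec_const {n : ℕ} (G : SimpleGraph (Fin n))
    (b : Fin n → Fin n → ℝ) (c : ℝ) :
    weightedLaplacian G b *ᵥ (fun _ => c) = 0 := by
  ext i
  have h : ∀ j, weightedLaplacian G b i j =
      (if i = j then ∑ k, (if G.Adj i k then b i k else 0) else 0) -
        (if G.Adj i j then b i j else 0) := by
    intro j
    by_cases hij : i = j
    · subst hij
      simp [weightedLaplacian]
    · by_cases hadj : G.Adj i j <;> simp [weightedLaplacian, hij, hadj]
  simp only [mulVec, dotProduct, ← Finset.sum_mul, h, Finset.sum_sub_distrib,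
    Finset.sum_ite_eq, Finset.mem_univ, if_true, sub_self, zero_mul, Pi.zero_apply]

theorem adj_iff_weightedLaplacian_ne_zero {n : ℕ} (G : SimpleGraph (Fin n))
    {b : Fin n → Fin n → ℝ} {i j : Fin n} (hij : i ≠ j) (hb : b i j ≠ 0) :
    G.Adj i j ↔ weightedLaplacian G b i j ≠ 0 := by
  simp [weightedLaplacian, hij, hb]

theorem laplacian_restrictions_distinct_of_graphs_distinct
    (n : ℕ) (hn : 1 ≤ n)
    (b : Fin n → Fin n → ℝ) (hsymm : ∀ i j, b i j = b j i)
    (hpos : ∀ i j, i ≠ j → 0 < b i j)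
    (G H : SimpleGraph (Fin n)) (hGconn : G.Connected) (hHconn : H.Connected)
    (hGH : G ≠ H) :
    ∃ x : Fin n → ℝ, (∑ i, x i = 0) ∧
      (weightedLaplacian G b) *ᵥ x ≠ (weightedLaplacian H b) *ᵥ x := by
  by_contra! hall
  have hn0 : (n : ℝ) ≠ 0 := by positivity
  apply hGH
  ext i j
  rcases eq_or_ne i j with rfl | hij
  · simp
  have hx := hall (Pi.single j 1 - fun _ => (n : ℝ)⁻¹) (by
    simp [Finset.sum_sub_distrib, hn0])
  rw [mulVec_sub, mulVec_sub, weightedLaplacian_mulVec_const,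
    weightedLaplacian_mulVec_const, sub_zero, sub_zero] at hx
  have hentry : weightedLaplacian G b i j = weightedLaplacian H b i j := by
    simpa using congrFun hx i
  have hb := (hpos i j hij).ne'
  rw [adj_iff_weightedLaplacian_ne_zero G hij hb,
    adj_iff_weightedLaplacian_ne_zero H hij hb, hentry]
end

section
/- Let F : ℝ^n → ℝ^m be a smooth (infinitely differentiable) function, and let Z = {x ∈ ℝ^n : F(x) = 0}. Suppose that for every x ∈ Z the total derivative DF(x) is not the zero linear map. Then Z has Lebesgue measure zero. -/
open MeasureTheory

/-- A function vanishing on a measurable set has zero derivative at almost every point of it. -/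
theorem ae_restrict_fderiv_eq_zero_of_eqOn_zero {n m : ℕ} {F : (Fin n → ℝ) → (Fin m → ℝ)}
    {s : Set (Fin n → ℝ)} (hs : MeasurableSet s) (hF : ∀ x ∈ s, DifferentiableAt ℝ F x)
    (h0 : ∀ x ∈ s, F x = 0) :
    ∀ᵐ x ∂volume.restrict s, fderiv ℝ F x = 0 := by
  let L : Fin m → ((Fin m → ℝ) →L[ℝ] (Fin n → ℝ)) := fun i =>
    ContinuousLinearMap.pi fun _ => ContinuousLinearMap.proj i
  have key : ∀ i, ∀ᵐ x ∂volume.restrict s, ‖(L i).comp (fderiv ℝ F x) - 0‖₊ ≤ 0 := by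
    intro i
    refine ApproximatesLinearOn.norm_fderiv_sub_le volume (f := fun x => L i (F x)) ?_ hs
      (fun x => (L i).comp (fderiv ℝ F x)) fun x hx =>
        ((L i).hasFDerivAt.comp x (hF x hx).hasFDerivAt).hasFDerivWithinAt
    intro x hx y hy
    simp [h0 x hx, h0 y hy]
  filter_upwards [ae_all_iff.2 key] with x hx
  ext v i
  rcases isEmpty_or_nonempty (Fin n) with _ | ⟨⟨j⟩⟩
  · simp [Subsingleton.elim v 0]
  · have h := hx i
    simp only [sub_zero, nonpos_iff_eq_zero, nnnorm_eq_zero] at h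
    simpa [L] using congrFun (DFunLike.congr_fun h v) j

theorem zero_set_of_smooth_map_with_nonvanishing_derivative_null
    (n m : ℕ) (F : (Fin n → ℝ) → (Fin m → ℝ)) (hF : ContDiff ℝ (⊤ : ℕ∞) F)
    (hDF : ∀ x, F x = 0 → fderiv ℝ F x ≠ 0) :
    volume {x : Fin n → ℝ | F x = 0} = 0 := by
  have hs : MeasurableSet {x : Fin n → ℝ | F x = 0} :=
    (isClosed_eq hF.continuous continuous_const).measurableSet
  have h := ae_restrict_fderiv_eq_zero_of_eqOn_zero hs
    (fun x _ => hF.differentiable (by simp) x) fun x hx => hx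
  rw [ae_restrict_iff' hs] at h
  refine measure_mono_null (fun x hx => ?_) (ae_iff.1 h)
  exact fun hx' => hDF x hx (hx' hx)
end

section
/- Let n ≥ 1 and let G and H be simple graphs on Fin n with G ≠ H. For each pair of indices i, j let g i j : ℝ → ℝ be a smooth function with g i j = g j i and with derivative (g i j)'(x) > 0 for every x ∈ ℝ. Then the set of vectors y ∈ ℝ^n satisfying, for every vertex i, Σ_{j : j adjacent to i in G} g i j (y j − y i) = Σ_{j : j adjacent to i in H} g i j (y j − y i), has Lebesgue measure zero. -/
open Classical MeasureTheory

/-- A measurable set meeting every line parallel to the `b`-th axis in at most one point is null. -/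
theorem volume_eq_zero_of_subsingleton_axis_lines {ι : Type*} [Fintype ι] [DecidableEq ι]
    {s : Set (ι → ℝ)} (hs : MeasurableSet s) (b : ι)
    (h : ∀ y ∈ s, ∀ c : ℝ, y + Pi.single b c ∈ s → c = 0) : volume s = 0 := by
  refine Measure.addHaar_eq_zero_of_disjoint_translates volume
    (fun k : ℕ => Pi.single b (1 / ((k : ℝ) + 1))) ?_ ?_ hs
  · have ht := tendsto_one_div_add_atTop_nhds_zero_nat (𝕜 := ℝ)
    have hc : Continuous (fun t : ℝ => (Pi.single b t : ι → ℝ)) :=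
      continuous_single (A := fun _ : ι => ℝ) b
    exact Metric.isBounded_range_of_tendsto _ ((hc.tendsto 0).comp ht)
  · intro k l hkl
    refine Set.disjoint_left.2 ?_
    intro x hx hx'
    simp only [Set.singleton_add, Set.mem_image] at hx hx'
    obtain ⟨y, hy, rfl⟩ := hx
    obtain ⟨z, hz, hzy⟩ := hx'
    have hz' : z = y + Pi.single b (1 / ((k : ℝ) + 1) - 1 / ((l : ℝ) + 1)) := by
      rw [Pi.single_sub]
      linear_combination (exp := 1) hzy
    have h0 := h y hy _ (hz' ▸ hz)
    apply hkl
    rw [sub_eq_zero, one_div, one_div] at h0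
    have h1 := inv_injective h0
    exact_mod_cast add_right_cancel h1

/-- If `ab` is an edge of `G` but not of `H`, the coupling terms at `a` agree only on a null set. -/
theorem coupling_agreement_at_vertex_null {ι : Type*} [Fintype ι] {G H : SimpleGraph ι}
    {a b : ι} (hG : G.Adj a b) (hH : ¬ H.Adj a b) {g : ι → ι → ℝ → ℝ}
    (hg : ∀ j, Continuous (g a j)) (hinj : Function.Injective (g a b)) :
    volume {y : ι → ℝ |
      (∑ j, if G.Adj a j then g a j (y j - y a) else 0) =
        (∑ j, if H.Adj a j then g a j (y j - y a) else 0)} = 0 := by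
  have hcont (K : SimpleGraph ι) :
      Continuous fun y : ι → ℝ => ∑ j, if K.Adj a j then g a j (y j - y a) else 0 := by
    refine continuous_finsetSum _ fun j _ => ?_
    split_ifs
    · have := hg j
      fun_prop
    · exact continuous_const
  refine volume_eq_zero_of_subsingleton_axis_lines
    (isClosed_eq (hcont G) (hcont H)).measurableSet b ?_
  intro y hy c hc
  rw [Set.mem_ofPred_eq] at hy hc
  have hab : a ≠ b := hG.ne
  have hoff (K : SimpleGraph ι) :
      (∑ j ∈ Finset.univ.erase b, if K.Adj a j then
        g a j ((y + (Pi.single b c : ι → ℝ)) j - (y + (Pi.single b c : ι → ℝ)) a) else 0) =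
      ∑ j ∈ Finset.univ.erase b, if K.Adj a j then g a j (y j - y a) else 0 := by
    refine Finset.sum_congr rfl fun j hj => ?_
    simp [Finset.ne_of_mem_erase hj, hab]
  simp only [← Finset.add_sum_erase _ _ (Finset.mem_univ b), hoff, if_pos hG, if_neg hH] at hy hc
  have h1 := hinj (add_right_cancel (hc.trans hy.symm))
  simpa [hab] using h1

theorem coupling_agreement_set_null
    (n : ℕ) (hn : 1 ≤ n) (G H : SimpleGraph (Fin n)) (hGH : G ≠ H)
    (g : Fin n → Fin n → ℝ → ℝ)
    (hg_smooth : ∀ i j, ContDiff ℝ (⊤ : ℕ∞) (g i j))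
    (hg_symm : ∀ i j, g i j = g j i)
    (hg_deriv : ∀ i j, ∀ x : ℝ, 0 < deriv (g i j) x) :
    volume {y : Fin n → ℝ |
      ∀ i, (∑ j, if G.Adj i j then g i j (y j - y i) else 0) =
           (∑ j, if H.Adj i j then g i j (y j - y i) else 0)} = 0 := by
  have hcont (i j) : Continuous (g i j) := (hg_smooth i j).continuous
  have hinj (i j) : Function.Injective (g i j) :=
    (strictMono_of_deriv_pos (hg_deriv i j)).injective
  obtain ⟨a, b, hab⟩ : ∃ a b, ¬ (G.Adj a b ↔ H.Adj a b) := by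
    by_contra! h
    exact hGH (by ext a b; exact h a b)
  by_cases hG : G.Adj a b
  · have hH : ¬ H.Adj a b := fun hH => hab (iff_of_true hG hH)
    exact measure_mono_null (fun y hy => hy a)
      (coupling_agreement_at_vertex_null hG hH (hcont a) (hinj a b))
  · have hH : H.Adj a b := by
      by_contra hH
      exact hab (iff_of_false hG hH)
    exact measure_mono_null (fun y hy => (hy a).symm)
      (coupling_agreement_at_vertex_null hH hG (hcont a) (hinj a b))
end

section
/- Let n ≥ 1. For each i let κ i : ℝ → ℝ be a smooth monotone nondecreasing function, and for each pair i, j let g i j : ℝ → ℝ be a smooth function with g i j = g j i and derivative (g i j)'(x) > 0 for all x ∈ ℝ. Call a vector w ∈ ℝ^n 'bad' if there exist two distinct simple graphs G ≠ H on Fin n and a vector y ∈ ℝ^n such that for every vertex i both κ i (y i) − Σ_{j adjacent to i in G} g i j (y j − y i) = w i and κ i (y i) − Σ_{j adjacent to i in H} g i j (y j − y i) = w i. Then the set of bad vectors has Lebesgue measure zero; consequently, for every probability measure ℙ on ℝ^n that is absolutely continuous with respect to Lebesgue measure, a vector w sampled from ℙ is bad with probability 0. -/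
open Classical MeasureTheory

/-- A vector `w` is *bad* if there are two distinct simple graphs `G ≠ H` on `Fin n` and a
vector `y` which is simultaneously a steady-state output of the diffusively coupled networked
system over `G` and over `H` with constant exogenous input `w`. A vector that is not bad is a
`𝔊`-indication vector. -/
def IsBadVector {n : ℕ} (κ : Fin n → ℝ → ℝ) (g : Fin n → Fin n → ℝ → ℝ)
    (w : Fin n → ℝ) : Prop :=
  ∃ G H : SimpleGraph (Fin n), G ≠ H ∧ ∃ y : Fin n → ℝ, ∀ i,
    κ i (y i) - (∑ j, if G.Adj i j then g i j (y j - y i) else 0) = w i ∧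
    κ i (y i) - (∑ j, if H.Adj i j then g i j (y j - y i) else 0) = w i

/-- A measurable set meeting every line of a fixed direction at most once is Lebesgue-null. -/
theorem volume_eq_zero_of_subsingleton_on_lines {n : ℕ} {S : Set (Fin n → ℝ)}
    (hS : MeasurableSet S) (v : Fin n → ℝ)
    (hv : ∀ y ∈ S, ∀ t : ℝ, y + t • v ∈ S → t = 0) : volume S = 0 := by
  refine Measure.addHaar_eq_zero_of_disjoint_translates volume
    (fun m : ℕ => (1 / ((m : ℝ) + 1)) • v) ?_ ?_ hS
  · have h := (tendsto_one_div_add_atTop_nhds_zero_nat (𝕜 := ℝ)).smul_const v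
    exact Metric.isBounded_range_of_tendsto _ h
  · intro a b hab
    refine Set.disjoint_left.2 fun x hxa hxb => hab ?_
    simp only [Set.singleton_add, Set.mem_image] at hxa hxb
    obtain ⟨p, hp, rfl⟩ := hxa
    obtain ⟨q, hq, hqp⟩ := hxb
    have hpq : q = p + (1 / ((a : ℝ) + 1) - 1 / ((b : ℝ) + 1)) • v := by
      rw [sub_smul, ← add_sub_assoc, eq_sub_iff_add_eq, add_comm q, hqp, add_comm p]
    have h := hv p hp _ (hpq ▸ hq)
    have h' : (a : ℝ) + 1 = (b : ℝ) + 1 := by simpa using sub_eq_zero.1 h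
    exact_mod_cast add_right_cancel h'

/-- The constant exogenous input for which `y` is a steady-state output over `G`. -/
noncomputable def steadyInput {n : ℕ} (κ : Fin n → ℝ → ℝ) (g : Fin n → Fin n → ℝ → ℝ)
    (G : SimpleGraph (Fin n)) (y : Fin n → ℝ) (i : Fin n) : ℝ :=
  κ i (y i) - (∑ j, if G.Adj i j then g i j (y j - y i) else 0)

theorem differentiable_steadyInput {n : ℕ} {κ : Fin n → ℝ → ℝ} {g : Fin n → Fin n → ℝ → ℝ}
    (hκ : ∀ i, Differentiable ℝ (κ i)) (hg : ∀ i j, Differentiable ℝ (g i j))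
    (G : SimpleGraph (Fin n)) : Differentiable ℝ (steadyInput κ g G) := by
  refine differentiable_pi.2 fun i => ?_
  refine ((hκ i).comp (differentiable_apply i)).sub (Differentiable.fun_sum fun j _ => ?_)
  split_ifs
  · exact (hg i j).comp ((differentiable_apply j).sub (differentiable_apply i))
  · exact differentiable_const 0

/-- Moving `y` in a coordinate `j ≠ i` changes the `i`-th input only through the edge `ij`. -/
theorem steadyInput_add_smul_single {n : ℕ} (κ : Fin n → ℝ → ℝ) (g : Fin n → Fin n → ℝ → ℝ)
    (G : SimpleGraph (Fin n)) (y : Fin n → ℝ) (t : ℝ) {i j : Fin n} (hij : i ≠ j) :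
    steadyInput κ g G (y + t • Pi.single j 1) i = steadyInput κ g G y i -
      if G.Adj i j then g i j (y j + t - y i) - g i j (y j - y i) else 0 := by
  have hi : (y + t • (Pi.single j 1 : Fin n → ℝ)) i = y i := by simp [hij]
  have hj : (y + t • (Pi.single j 1 : Fin n → ℝ)) j = y j + t := by simp
  have hk : ∀ k ∈ Finset.univ.erase j, (y + t • (Pi.single j 1 : Fin n → ℝ)) k = y k := by
    intro k hk
    simp [Finset.ne_of_mem_erase hk]
  unfold steadyInput
  rw [← Finset.add_sum_erase _ _ (Finset.mem_univ j),
    ← Finset.add_sum_erase _ (fun k => if G.Adj i k then g i k (y k - y i) else 0)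
      (Finset.mem_univ j),
    Finset.sum_congr rfl fun k h => by rw [hk k h, hi], hi, hj]
  split_ifs <;> ring

theorem volume_steadyInput_eq_eq_zero_of_adj {n : ℕ} {κ : Fin n → ℝ → ℝ}
    {g : Fin n → Fin n → ℝ → ℝ} (hκ : ∀ i, Differentiable ℝ (κ i))
    (hg : ∀ i j, Differentiable ℝ (g i j)) (hg_inj : ∀ i j, Function.Injective (g i j))
    {G H : SimpleGraph (Fin n)} {i j : Fin n} (hG : G.Adj i j) (hH : ¬ H.Adj i j) :
    volume {y | steadyInput κ g G y = steadyInput κ g H y} = 0 := by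
  refine volume_eq_zero_of_subsingleton_on_lines
    (isClosed_eq (differentiable_steadyInput hκ hg G).continuous
      (differentiable_steadyInput hκ hg H).continuous).measurableSet (Pi.single j 1) ?_
  intro y hy t hyt
  have hy' := congrFun hy i
  have hyt' := congrFun hyt i
  rw [steadyInput_add_smul_single κ g G y t hG.ne, steadyInput_add_smul_single κ g H y t hG.ne,
    if_pos hG, if_neg hH, hy'] at hyt'
  have h := hg_inj i j (show g i j (y j + t - y i) = g i j (y j - y i) by linarith)
  linarith

theorem volume_steadyInput_eq_eq_zero {n : ℕ} {κ : Fin n → ℝ → ℝ}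
    {g : Fin n → Fin n → ℝ → ℝ} (hκ : ∀ i, Differentiable ℝ (κ i))
    (hg : ∀ i j, Differentiable ℝ (g i j)) (hg_inj : ∀ i j, Function.Injective (g i j))
    {G H : SimpleGraph (Fin n)} (hGH : G ≠ H) :
    volume {y | steadyInput κ g G y = steadyInput κ g H y} = 0 := by
  obtain ⟨i, j, hij⟩ : ∃ i j, ¬ (G.Adj i j ↔ H.Adj i j) := by
    by_contra! h
    exact hGH (SimpleGraph.ext (funext₂ fun i j => propext (h i j)))
  by_cases hG : G.Adj i j
  · exact volume_steadyInput_eq_eq_zero_of_adj hκ hg hg_inj hG fun hH => hij (iff_of_true hG hH)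
  · have hH : H.Adj i j := by
      by_contra hH
      exact hij (iff_of_false hG hH)
    simpa only [eq_comm] using volume_steadyInput_eq_eq_zero_of_adj hκ hg hg_inj hH hG

theorem bad_vectors_null_and_indication_with_probability_one
    (n : ℕ) (hn : 1 ≤ n)
    (κ : Fin n → ℝ → ℝ)
    (hκ_smooth : ∀ i, ContDiff ℝ (⊤ : ℕ∞) (κ i))
    (hκ_mono : ∀ i, Monotone (κ i))
    (g : Fin n → Fin n → ℝ → ℝ)
    (hg_smooth : ∀ i j, ContDiff ℝ (⊤ : ℕ∞) (g i j))
    (hg_symm : ∀ i j, g i j = g j i)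
    (hg_deriv : ∀ i j, ∀ x : ℝ, 0 < deriv (g i j) x) :
    volume {w : Fin n → ℝ | IsBadVector κ g w} = 0 ∧
    ∀ ℙ : Measure (Fin n → ℝ), IsProbabilityMeasure ℙ → ℙ ≪ volume →
      ℙ {w : Fin n → ℝ | IsBadVector κ g w} = 0 := by
  have hκ : ∀ i, Differentiable ℝ (κ i) := fun i => (hκ_smooth i).differentiable (by simp)
  have hg : ∀ i j, Differentiable ℝ (g i j) := fun i j =>
    (hg_smooth i j).differentiable (by simp)
  have hg_inj : ∀ i j, Function.Injective (g i j) := fun i j =>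
    (strictMono_of_deriv_pos (hg_deriv i j)).injective
  have hnull : volume {w : Fin n → ℝ | IsBadVector κ g w} = 0 := by
    refine measure_mono_null (t := ⋃ (G : SimpleGraph (Fin n)) (H : SimpleGraph (Fin n))
      (_ : G ≠ H), steadyInput κ g G '' {y | steadyInput κ g G y = steadyInput κ g H y}) ?_ ?_
    · rintro w ⟨G, H, hGH, y, hy⟩
      simp only [Set.mem_iUnion]
      exact ⟨G, H, hGH, y, funext fun i => (hy i).1.trans (hy i).2.symm,
        funext fun i => (hy i).1⟩
    · refine measure_iUnion_null fun G => measure_iUnion_null fun H =>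
        measure_iUnion_null fun hGH => ?_
      exact addHaar_image_eq_zero_of_differentiableOn_of_addHaar_eq_zero volume
        (differentiable_steadyInput hκ hg G).differentiableOn
        (volume_steadyInput_eq_eq_zero hκ hg hg_inj hGH)
  exact ⟨hnull, fun ℙ _ hℙ => hℙ hnull⟩
end

section
/- Let n, K, M be natural numbers with M > 2K, and let m : Fin n → ℤ satisfy |m i| ≤ K for every i. If Σ_{i} m i · M^i = 0, then m i = 0 for every i. -/
theorem signed_digit_representation_unique
    (n K M : ℕ) (hM : M > 2 * K) (m : Fin n → ℤ)
    (hbound : ∀ i, |m i| ≤ (K : ℤ))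
    (hsum : ∑ i, m i * (M : ℤ) ^ (i : ℕ) = 0) :
    ∀ i, m i = 0 := by
  induction n with
  | zero => exact fun i => i.elim0
  | succ n ih =>
    have hsplit : m 0 + (M : ℤ) * ∑ i : Fin n, m i.succ * (M : ℤ) ^ (i : ℕ) = 0 := by
      rw [← hsum, Fin.sum_univ_succ, Finset.mul_sum]
      simp only [Fin.val_zero, pow_zero, mul_one, Fin.val_succ, pow_succ]
      congr 1
      exact Finset.sum_congr rfl fun i _ => by ring
    have hzero : m 0 = 0 := by
      refine Int.eq_zero_of_abs_lt_dvd (m := (M : ℤ)) ?_ ((hbound 0).trans_lt (by lia))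
      exact (dvd_add_left (dvd_mul_right _ _)).mp (hsplit ▸ dvd_zero _)
    have hM0 : (M : ℤ) ≠ 0 := by lia
    rw [hzero, zero_add] at hsplit
    have htail := (mul_eq_zero.mp hsplit).resolve_left hM0
    exact Fin.cases hzero (ih (fun i => m i.succ) (fun i => hbound i.succ) htail)
end

section
/- Let n, N, D, M be natural numbers with D ≥ 1 and M > (2N+1)·D, and define w ∈ ℚ^n by w j = M^j. Let X and Y be n×n matrices with rational entries such that every entry z of X or Y satisfies |z| ≤ N and D·z ∈ ℤ (denominators divide D, numerators bounded by N in absolute value). If X ≠ Y, then X·w ≠ Y·w. -/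
open Matrix

/-- Radix expansions with signed digits smaller than the base in absolute value represent zero
only trivially. -/
theorem eq_zero_of_sum_mul_pow_eq_zero {M : ℤ} {n : ℕ} (d : Fin n → ℤ)
    (hd : ∀ j, |d j| < M) (h : ∑ j, d j * M ^ (j : ℕ) = 0) : d = 0 := by
  induction n with
  | zero => exact Subsingleton.elim _ _
  | succ n ih =>
    have hM : M ≠ 0 := ((abs_nonneg _).trans_lt (hd 0)).ne'
    have hsplit : d 0 + M * ∑ j : Fin n, d j.succ * M ^ (j : ℕ) = 0 := by
      rw [← h, Fin.sum_univ_succ, Finset.mul_sum]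
      simp only [Fin.val_zero, pow_zero, mul_one, Fin.val_succ, pow_succ]
      congr 1
      exact Finset.sum_congr rfl fun j _ => by ring
    have h0 : d 0 = 0 :=
      Int.eq_zero_of_abs_lt_dvd ⟨-∑ j : Fin n, d j.succ * M ^ (j : ℕ), by linarith⟩ (hd 0)
    have htail : (fun j : Fin n => d j.succ) = 0 := by
      refine ih _ (fun j => hd j.succ) ?_
      simpa [h0, hM] using hsplit
    funext j
    exact Fin.cases h0 (fun j => congrFun htail j) j

theorem radix_vector_is_indication_vector
    (n N D M : ℕ) (hD : 1 ≤ D) (hM : M > (2 * N + 1) * D)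
    (w : Fin n → ℚ) (hw : ∀ j, w j = (M : ℚ) ^ (j : ℕ))
    (X Y : Matrix (Fin n) (Fin n) ℚ)
    (hXN : ∀ i j, |X i j| ≤ (N : ℚ)) (hYN : ∀ i j, |Y i j| ≤ (N : ℚ))
    (hXD : ∀ i j, ∃ z : ℤ, (D : ℚ) * X i j = (z : ℚ))
    (hYD : ∀ i j, ∃ z : ℤ, (D : ℚ) * Y i j = (z : ℚ))
    (hXY : X ≠ Y) :
    X *ᵥ w ≠ Y *ᵥ w := by
  intro h
  apply hXY
  choose x hx using hXD
  choose y hy using hYD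
  have hD0 : (0 : ℚ) < D := by exact_mod_cast hD
  have hMq : (2 * N + 1) * D < (M : ℚ) := by exact_mod_cast hM
  have hcast : ∀ i j, ((x i j - y i j : ℤ) : ℚ) = D * (X i j - Y i j) := fun i j => by
    rw [Int.cast_sub, ← hx, ← hy, mul_sub]
  ext i j
  have hdigits : (fun j => x i j - y i j) = 0 := by
    refine eq_zero_of_sum_mul_pow_eq_zero (M := M) _ (fun j => ?_) ?_
    · have hdiff : |X i j - Y i j| ≤ 2 * N := by
        linarith [abs_sub (X i j) (Y i j), hXN i j, hYN i j]
      have hq : |((x i j - y i j : ℤ) : ℚ)| < M := by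
        rw [hcast, abs_mul, abs_of_pos hD0]
        nlinarith [mul_le_mul_of_nonneg_left hdiff hD0.le]
      exact_mod_cast hq
    · have hrow : ∑ j, X i j * w j = ∑ j, Y i j * w j := congrFun h i
      have hq : ∑ j, ((x i j - y i j : ℤ) : ℚ) * (M : ℚ) ^ (j : ℕ) = 0 := by
        simp only [hcast, ← hw, mul_assoc, sub_mul, ← Finset.mul_sum, Finset.sum_sub_distrib,
          hrow, sub_self, mul_zero]
      exact_mod_cast hq
  have hzero : (D : ℚ) * (X i j - Y i j) = 0 := by
    rw [← hcast, show x i j - y i j = 0 from congrFun hdigits j, Int.cast_zero]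
  exact sub_eq_zero.mp ((mul_eq_zero.mp hzero).resolve_left hD0.ne')
end
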